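/- Let X be a Polish space, (Y, ρ) a metric space, and f : X → Y a function such that (i) f⁻¹[B] is an EBP-set for every open ball B ⊆ Y, and (ii) f⁻¹[V] ⊆ CR(f⁻¹[V]) for every open set V ⊆ Y. Then the set of points of continuity of f is a dense Gδ subset of X. -/

import Mathlib

open MeasureTheory Set Topology
open scoped ENNReal symmDiff

/-- The annihilator of a set `A`: the set of Borel probability measures `μ` on `X`
whose induced outer measure vanishes on `A`. -/
def Annihilator {X : Type*} [MeasurableSpace X] (A : Set X) :
    Set (ProbabilityMeasure X) :=
  {μ : ProbabilityMeasure X | μ.toMeasure A = 0}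

/-- `A` is residually null if its annihilator is comeager in the space `𝓜(X)` of
Borel probability measures with the topology of weak convergence. -/
def ResiduallyNull {X : Type*} [TopologicalSpace X] [MeasurableSpace X]
    [OpensMeasurableSpace X] (A : Set X) : Prop :=
  Annihilator A ∈ residual (ProbabilityMeasure X)

/-- `A` is an EBP-set (extended Baire property) if its symmetric difference with some
open set is residually null. -/
def EBPSet {X : Type*} [TopologicalSpace X] [MeasurableSpace X]
    [OpensMeasurableSpace X] (A : Set X) : Prop :=
  ∃ U : Set X, IsOpen U ∧ ResiduallyNull (A ∆ U)

/-- `ROp A` is the union of all open sets `U` such that `U ∩ A` is residually null. -/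
def ROp {X : Type*} [TopologicalSpace X] [MeasurableSpace X]
    [OpensMeasurableSpace X] (A : Set X) : Set X :=
  ⋃₀ {U : Set X | IsOpen U ∧ ResiduallyNull (U ∩ A)}

/-- `CROp A = X \ ROp A`. -/
def CROp {X : Type*} [TopologicalSpace X] [MeasurableSpace X]
    [OpensMeasurableSpace X] (A : Set X) : Set X :=
  (ROp A)ᶜ

theorem ResiduallyNull.mono {X : Type*} [TopologicalSpace X] [MeasurableSpace X]
    [OpensMeasurableSpace X] {A B : Set X} (hB : ResiduallyNull B) (h : A ⊆ B) :
    ResiduallyNull A :=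
  Filter.mem_of_superset hB fun _ hμ => measure_mono_null h hμ

/-- A set that lies in its own `CROp` is disjoint from every open set `W` that it meets in a
residually null set. -/
theorem notMem_of_residuallyNull_inter {X : Type*} [TopologicalSpace X] [MeasurableSpace X]
    [OpensMeasurableSpace X] {A W : Set X} (hA : A ⊆ CROp A) (hW : IsOpen W)
    (hWA : ResiduallyNull (W ∩ A)) {x : X} (hx : x ∈ W) : x ∉ A :=
  fun hxA => hA hxA ⟨W, ⟨hW, hWA⟩, hx⟩

/-- Every nonempty open set contains a nonempty open set on which `f` has small oscillation. -/
theorem exists_isOpen_subset_dist_le {X : Type*} [TopologicalSpace X] [MeasurableSpace X]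
    [OpensMeasurableSpace X] {Y : Type*} [PseudoMetricSpace Y] {f : X → Y}
    (h1 : ∀ (y : Y) (r : ℝ), EBPSet (f ⁻¹' Metric.ball y r))
    (h2 : ∀ V : Set Y, IsOpen V → f ⁻¹' V ⊆ CROp (f ⁻¹' V))
    {U : Set X} (hU : IsOpen U) (hne : U.Nonempty) {ε : ℝ} (hε : 0 < ε) :
    ∃ W ⊆ U, IsOpen W ∧ W.Nonempty ∧ ∀ a ∈ W, ∀ b ∈ W, dist (f a) (f b) ≤ ε := by
  obtain ⟨x, hx⟩ := hne
  obtain ⟨G, hG, hAG⟩ := h1 (f x) (ε / 2)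
  have near : ∀ a ∈ U ∩ G, dist (f a) (f x) ≤ ε / 2 := by
    intro a ha
    by_contra! hlt
    refine notMem_of_residuallyNull_inter
      (h2 (Metric.closedBall (f x) (ε / 2))ᶜ Metric.isClosed_closedBall.isOpen_compl)
      (hU.inter hG) (hAG.mono ?_) ha (by simpa using hlt)
    rintro z ⟨hz, hzV⟩
    exact Or.inr ⟨hz.2, fun hzA => hzV (Metric.ball_subset_closedBall hzA)⟩
  refine ⟨U ∩ G, inter_subset_left, hU.inter hG, ?_, fun a ha b hb => ?_⟩
  · by_contra hempty
    refine notMem_of_residuallyNull_inter (h2 _ Metric.isOpen_ball) hU (hAG.mono ?_) hx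
      (Metric.mem_ball_self (half_pos hε))
    exact fun z hz => Or.inl ⟨hz.2, fun hzG => hempty ⟨z, hz.1, hzG⟩⟩
  · linarith [dist_triangle_right (f a) (f b) (f x), near a ha, near b hb]

/-- If preimages of open balls are EBP-sets and `f⁻¹[V] ⊆ CR(f⁻¹[V])` for every open `V`,
then the set of points of continuity of `f` is a dense `Gδ` subset of `X`. -/
theorem continuity_points_dense_Gdelta {X : Type*} [TopologicalSpace X] [PolishSpace X]
    [MeasurableSpace X] [BorelSpace X] {Y : Type*} [MetricSpace Y] (f : X → Y)
    (h1 : ∀ (y : Y) (r : ℝ), EBPSet (f ⁻¹' Metric.ball y r))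
    (h2 : ∀ V : Set Y, IsOpen V → f ⁻¹' V ⊆ CROp (f ⁻¹' V)) :
    Dense {x : X | ContinuousAt f x} ∧ IsGδ {x : X | ContinuousAt f x} := by
  let _ := TopologicalSpace.upgradeIsCompletelyMetrizable X
  refine ⟨?_, IsGδ.setOfPred_continuousAt f⟩
  let D : ℕ → Set X := fun n =>
    ⋃₀ {W | IsOpen W ∧ ∀ a ∈ W, ∀ b ∈ W, dist (f a) (f b) ≤ 1 / ((n : ℝ) + 1)}
  have hD : Dense (⋂ n, D n) := by
    refine dense_iInter_of_isOpen (fun n => isOpen_sUnion fun W hW => hW.1) fun n => ?_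
    refine dense_iff_inter_open.2 fun U hU hne => ?_
    obtain ⟨W, hWU, hW, ⟨x, hx⟩, hosc⟩ :=
      exists_isOpen_subset_dist_le h1 h2 hU hne (Nat.one_div_pos_of_nat (α := ℝ) (n := n))
    exact ⟨x, hWU hx, W, ⟨hW, hosc⟩, hx⟩
  refine hD.mono fun x hx => Metric.tendsto_nhds.2 fun ε hε => ?_
  obtain ⟨n, hn⟩ := exists_nat_one_div_lt hε
  obtain ⟨W, ⟨hW, hosc⟩, hxW⟩ := mem_iInter.1 hx n
  filter_upwards [hW.mem_nhds hxW] with a ha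
  exact (hosc a ha x hxW).trans_lt hn
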